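/- For every m ≥ 1, the map ℓ ↦ P_ℓ(𝔇_{β_m} ≥ ℓ) is non-increasing on ℤ; that is, P_{ℓ+1}(𝔇_{β_m} ≥ ℓ+1) ≤ P_ℓ(𝔇_{β_m} ≥ ℓ) for all ℓ ∈ ℤ. -/

import Mathlib

open MeasureTheory Filter ProbabilityTheory

noncomputable section

/-- One-step transition probability of the urn discrepancy chain with parameter `lam`:
from state `i`, jump to `i+1` with probability `lam^(2i-1)/(1+lam^(2i-1))` and to `i-1`
with probability `1/(1+lam^(2i-1))`. -/
def urnStep (lam : ℝ) (i j : ℤ) : ℝ :=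
  if j = i + 1 then lam ^ (2 * i - 1) / (1 + lam ^ (2 * i - 1))
  else if j = i - 1 then 1 / (1 + lam ^ (2 * i - 1))
  else 0

/-- `P` is the family of laws (indexed by the starting point) of the urn discrepancy
chain with parameter `lam`, characterized by its cylinder probabilities. -/
def IsUrnChain (lam : ℝ) (P : ℤ → Measure (ℕ → ℤ)) : Prop :=
  (∀ x, IsProbabilityMeasure (P x)) ∧
    ∀ (x : ℤ) (n : ℕ) (p : ℕ → ℤ),
      (P x {ω | ∀ i ≤ n, ω i = p i}).toReal =
        (if p 0 = x then (1 : ℝ) else 0) *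
          ∏ i ∈ Finset.range n, urnStep lam (p i) (p (i + 1))

/-- Number of down-steps of the path `ω` during the time interval `[1, j]`. -/
def downCount (ω : ℕ → ℤ) (j : ℕ) : ℕ :=
  ((Finset.Icc 1 j).filter fun ℓ => ω ℓ = ω (ℓ - 1) - 1).card

/-- `betaTime ω i` is the time of the `i`-th down-step of the path `ω`. -/
def betaTime (ω : ℕ → ℤ) (i : ℕ) : ℕ :=
  sInf {j | 1 ≤ j ∧ downCount ω j = i}

/-- The probability distribution `π(x) = lam^(x²) / Σ_y lam^(y²)` on `ℤ`. -/
def urnPi (lam : ℝ) (x : ℤ) : ℝ :=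
  lam ^ (x ^ 2) / ∑' y : ℤ, lam ^ (y ^ 2)

lemma urnStep_up (lam : ℝ) (i : ℤ) :
    urnStep lam i (i + 1) = lam ^ (2 * i - 1) / (1 + lam ^ (2 * i - 1)) := by
  simp [urnStep]

lemma urnStep_down (lam : ℝ) (i : ℤ) :
    urnStep lam i (i - 1) = 1 / (1 + lam ^ (2 * i - 1)) := by
  have h : i - 1 ≠ i + 1 := by omega
  simp [urnStep, h]

lemma urnStep_eq_zero {lam : ℝ} {i j : ℤ} (h : ¬(j = i + 1 ∨ j = i - 1)) :
    urnStep lam i j = 0 := by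
  push Not at h
  simp [urnStep, h.1, h.2]

lemma urnStep_up_nonneg {lam : ℝ} (h0 : 0 < lam) (i : ℤ) : 0 ≤ urnStep lam i (i + 1) := by
  rw [urnStep_up]
  positivity

lemma urnStep_down_nonneg {lam : ℝ} (h0 : 0 < lam) (i : ℤ) : 0 ≤ urnStep lam i (i - 1) := by
  rw [urnStep_down]
  positivity

lemma urnStep_up_add_down {lam : ℝ} (h0 : 0 < lam) (i : ℤ) :
    urnStep lam i (i + 1) + urnStep lam i (i - 1) = 1 := by
  have h : 0 < lam ^ (2 * i - 1) := by positivity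
  rw [urnStep_up, urnStep_down]
  field_simp
  ring

lemma urnStep_up_succ_le {lam : ℝ} (h0 : 0 < lam) (h1 : lam < 1) (i : ℤ) :
    urnStep lam (i + 1) (i + 1 + 1) ≤ urnStep lam i (i + 1) := by
  have ha : 0 < lam ^ (2 * i - 1) := by positivity
  have hb : 0 < lam ^ (2 * (i + 1) - 1) := by positivity
  have hab : lam ^ (2 * (i + 1) - 1) ≤ lam ^ (2 * i - 1) :=
    zpow_le_zpow_right_of_le_one₀ h0 h1.le (by omega)
  rw [urnStep_up, urnStep_up, div_le_div_iff₀ (by positivity) (by positivity)]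
  nlinarith

/-- The probability that the chain started at `x` is at least `t` after `n` steps. -/
def urnTail (lam : ℝ) (t : ℤ) : ℕ → ℤ → ℝ
  | 0, x => if t ≤ x then 1 else 0
  | n + 1, x => urnStep lam x (x + 1) * urnTail lam t n (x + 1) +
      urnStep lam x (x - 1) * urnTail lam t n (x - 1)

lemma urnTail_le_add_two {lam : ℝ} (h0 : 0 < lam) (t : ℤ) (n : ℕ) (x : ℤ) :
    urnTail lam t n x ≤ urnTail lam t n (x + 2) := by
  induction n generalizing x with
  | zero =>
    simp only [urnTail]
    split_ifs <;> first | omega | norm_num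
  | succ n ih =>
    have e1 : urnTail lam t (n + 1) x ≤ urnTail lam t n (x + 1) := by
      have h := ih (x - 1)
      rw [show x - 1 + 2 = x + 1 by ring] at h
      have hs := urnStep_up_add_down h0 x
      have hd := urnStep_down_nonneg h0 x
      rw [urnTail, eq_sub_of_add_eq hs]
      linarith [mul_le_mul_of_nonneg_left h hd]
    have e2 : urnTail lam t n (x + 1) ≤ urnTail lam t (n + 1) (x + 2) := by
      have h := ih (x + 1)
      rw [show x + 1 + 2 = x + 2 + 1 by ring] at h
      have hs := urnStep_up_add_down h0 (x + 2)
      have hu := urnStep_up_nonneg h0 (x + 2)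
      rw [urnTail, eq_sub_of_add_eq' hs, show x + 2 - 1 = x + 1 by ring]
      linarith [mul_le_mul_of_nonneg_left h hu]
    exact e1.trans e2

lemma urnTail_shift_le {lam : ℝ} (h0 : 0 < lam) (h1 : lam < 1) (t : ℤ) (n : ℕ) (x : ℤ) :
    urnTail lam (t + 1) n (x + 1) ≤ urnTail lam t n x := by
  induction n generalizing x with
  | zero => simp [urnTail]
  | succ n ih =>
    have hu := ih (x + 1)
    have hd := ih (x - 1)
    have hm := urnTail_le_add_two h0 t n (x - 1)
    rw [show x - 1 + 2 = x + 1 by ring] at hm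
    have hs := urnStep_up_add_down h0 x
    have hs' := urnStep_up_add_down h0 (x + 1)
    have hu' := urnStep_up_nonneg h0 (x + 1)
    have hd' := urnStep_down_nonneg h0 (x + 1)
    have hle := urnStep_up_succ_le h0 h1 x
    rw [show x + 1 - 1 = x - 1 + 1 by ring] at hs' hd'
    rw [urnTail, urnTail, show x + 1 - 1 = x - 1 + 1 by ring, eq_sub_of_add_eq' hs]
    have hdown := mul_le_mul_of_nonneg_left hd hd'
    rw [eq_sub_of_add_eq' hs'] at hdown ⊢
    linarith [mul_le_mul_of_nonneg_left hu hu', mul_nonneg (sub_nonneg.2 hle) (sub_nonneg.2 hm)]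

/-- Almost surely, the urn chain starts at `x` and makes nearest-neighbour steps. -/
lemma IsUrnChain.ae_path {lam : ℝ} {P : ℤ → Measure (ℕ → ℤ)} (hP : IsUrnChain lam P) (x : ℤ) :
    ∀ᵐ ω ∂P x, ω 0 = x ∧ ∀ n, ω (n + 1) = ω n + 1 ∨ ω (n + 1) = ω n - 1 := by
  have := hP.1
  suffices h : ∀ n, ∀ᵐ ω ∂P x, ω 0 = x ∧ (ω (n + 1) = ω n + 1 ∨ ω (n + 1) = ω n - 1) by
    filter_upwards [ae_all_iff.2 h] with ω hω
    exact ⟨(hω 0).1, fun n => (hω n).2⟩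
  intro n
  rw [ae_iff]
  set B := {ω : ℕ → ℤ | ¬(ω 0 = x ∧ (ω (n + 1) = ω n + 1 ∨ ω (n + 1) = ω n - 1))}
  have hsub : B ⊆ ⋃ p : Fin (n + 2) → ℤ, {ω | ω ∈ B ∧ ∀ i : Fin (n + 2), ω i = p i} :=
    fun ω hω => Set.mem_iUnion.2 ⟨fun i => ω i, hω, fun _ => rfl⟩
  refine measure_mono_null hsub (measure_iUnion_null fun p => ?_)
  rcases Set.eq_empty_or_nonempty {ω | ω ∈ B ∧ ∀ i : Fin (n + 2), ω i = p i} with h | ⟨q, hqB, hq⟩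
  · rw [h, measure_empty]
  · refine measure_mono_null (t := {ω | ∀ i ≤ n + 1, ω i = q i}) ?_ ?_
    · rintro ω ⟨-, hω⟩ i hi
      exact (hω ⟨i, by omega⟩).trans (hq ⟨i, by omega⟩).symm
    · refine ((ENNReal.toReal_eq_zero_iff _).1 ?_).resolve_right (measure_ne_top _ _)
      rw [hP.2 x (n + 1) q]
      by_cases h0 : q 0 = x
      · have hstep : ¬(q (n + 1) = q n + 1 ∨ q (n + 1) = q n - 1) := fun h => hqB ⟨h0, h⟩
        rw [Finset.prod_range_succ, urnStep_eq_zero hstep, mul_zero, mul_zero]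
      · rw [if_neg h0, zero_mul]

lemma IsUrnChain.measureReal_cylinder_update {lam : ℝ} {P : ℤ → Measure (ℕ → ℤ)}
    (hP : IsUrnChain lam P) (x : ℤ) (k : ℕ) (p : ℕ → ℤ) (y : ℤ) :
    (P x).real {ω | ∀ i ≤ k + 1, ω i = Function.update p (k + 1) y i} =
      (P x).real {ω | ∀ i ≤ k, ω i = p i} * urnStep lam (p k) y := by
  simp only [Measure.real]
  rw [hP.2, hP.2, Finset.prod_range_succ, mul_assoc]
  simp only [Function.update_self, Function.update_of_ne (Nat.succ_ne_self k).symm,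
    Function.update_of_ne (Nat.succ_ne_zero k).symm]
  congr 2
  refine Finset.prod_congr rfl fun i hi => ?_
  have hi' := Finset.mem_range.1 hi
  rw [Function.update_of_ne (by omega), Function.update_of_ne (by omega)]

lemma mem_cylinder_update {k : ℕ} {p ω : ℕ → ℤ} {y : ℤ} :
    (∀ i ≤ k + 1, ω i = Function.update p (k + 1) y i) ↔
      (∀ i ≤ k, ω i = p i) ∧ ω (k + 1) = y := by
  constructor
  · intro h
    refine ⟨fun i hi => ?_, by simpa using h (k + 1) le_rfl⟩
    rw [h i (by omega), Function.update_of_ne (by omega)]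
  · rintro ⟨h, h'⟩ i hi
    rcases Nat.lt_or_ge k i with hk | hk
    · obtain rfl : i = k + 1 := by omega
      simpa using h'
    · rw [h i hk, Function.update_of_ne (by omega)]

lemma measurableSet_cylinder (k : ℕ) (p : ℕ → ℤ) :
    MeasurableSet {ω : ℕ → ℤ | ∀ i ≤ k, ω i = p i} := by
  measurability

/-- Markov property of the urn chain at a cylinder, for the tail at a deterministic time. -/
lemma IsUrnChain.measureReal_cylinder_inter_tail {lam : ℝ} {P : ℤ → Measure (ℕ → ℤ)}
    (hP : IsUrnChain lam P) (x t : ℤ) (n k : ℕ) (p : ℕ → ℤ) :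
    (P x).real ({ω | ∀ i ≤ k, ω i = p i} ∩ {ω | t ≤ ω (k + n)}) =
      (P x).real {ω | ∀ i ≤ k, ω i = p i} * urnTail lam t n (p k) := by
  have := hP.1
  induction n generalizing k p with
  | zero =>
    simp only [urnTail]
    split_ifs with h
    · rw [mul_one]
      congr 1
      ext ω
      simp only [Set.mem_inter_iff, Set.mem_ofPred_eq, and_iff_left_iff_imp]
      intro hω
      rwa [Nat.add_zero, hω k le_rfl]
    · rw [mul_zero]
      convert measureReal_empty (μ := P x)
      ext ω
      simp only [Set.mem_inter_iff, Set.mem_ofPred_eq, Set.mem_empty_iff_false, iff_false, not_and]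
      intro hω
      rwa [Nat.add_zero, hω k le_rfl]
  | succ n ih =>
    have hu := ih (k + 1) (Function.update p (k + 1) (p k + 1))
    have hd := ih (k + 1) (Function.update p (k + 1) (p k - 1))
    rw [hP.measureReal_cylinder_update, Function.update_self,
      show k + 1 + n = k + (n + 1) by ring] at hu hd
    rw [urnTail, mul_add, ← mul_assoc, ← mul_assoc, ← hu, ← hd, ← measureReal_union]
    · refine measureReal_congr ?_
      filter_upwards [hP.ae_path x] with ω hω
      refine propext ?_
      change (_ ∧ _) ↔ (_ ∧ _) ∨ (_ ∧ _)
      simp only [Set.mem_ofPred_eq]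
      have hk := hω.2 k
      rw [mem_cylinder_update, mem_cylinder_update]
      constructor
      · rintro ⟨h, h'⟩
        rw [h k le_rfl] at hk
        exact hk.imp (fun hk => ⟨⟨h, hk⟩, h'⟩) (fun hk => ⟨⟨h, hk⟩, h'⟩)
      · rintro (⟨⟨h, -⟩, h'⟩ | ⟨⟨h, -⟩, h'⟩) <;> exact ⟨h, h'⟩
    · refine Set.disjoint_left.2 ?_
      rintro ω ⟨h, -⟩ ⟨h', -⟩
      have e := (mem_cylinder_update.1 h).2
      have e' := (mem_cylinder_update.1 h').2
      omega
    · exact (measurableSet_cylinder _ _).inter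
        (measurableSet_le measurable_const (measurable_pi_apply _))

lemma IsUrnChain.measureReal_tail {lam : ℝ} {P : ℤ → Measure (ℕ → ℤ)}
    (hP : IsUrnChain lam P) (x t : ℤ) (n : ℕ) :
    (P x).real {ω | t ≤ ω n} = urnTail lam t n x := by
  have h := hP.measureReal_cylinder_inter_tail x t n 0 (fun _ => x)
  have h1 : (P x).real {ω | ∀ i ≤ 0, ω i = (fun _ => x) i} = 1 := by
    simp only [Measure.real]
    rw [hP.2]
    simp
  rw [h1, one_mul, Nat.zero_add] at h
  rw [← h]
  refine measureReal_congr ?_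
  filter_upwards [hP.ae_path x] with ω hω
  refine propext ?_
  change t ≤ ω n ↔ (∀ i ≤ 0, ω i = x) ∧ t ≤ ω n
  simp [hω.1]

lemma downCount_zero (ω : ℕ → ℤ) : downCount ω 0 = 0 := by
  simp [downCount]

lemma downCount_succ (ω : ℕ → ℤ) (j : ℕ) :
    downCount ω (j + 1) = downCount ω j + if ω (j + 1) = ω j - 1 then 1 else 0 := by
  unfold downCount
  rw [← Finset.insert_Icc_right_eq_Icc_add_one (by omega), Finset.filter_insert]
  split_ifs with h h' h'
  · rw [Finset.card_insert_of_notMem (by simp)]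
  · exact absurd h h'
  · exact absurd h' h
  · rfl

lemma downCount_mono (ω : ℕ → ℤ) : Monotone (downCount ω) :=
  monotone_nat_of_le_succ fun j => by rw [downCount_succ]; omega

lemma exists_downCount_eq {ω : ℕ → ℤ} {m n : ℕ} (h : m ≤ downCount ω n) :
    ∃ j ≤ n, downCount ω j = m := by
  induction n with
  | zero => exact ⟨0, le_rfl, by rw [downCount_zero] at h ⊢; omega⟩
  | succ n ih =>
    by_cases hn : m ≤ downCount ω n
    · obtain ⟨j, hj, hjm⟩ := ih hn
      exact ⟨j, by omega, hjm⟩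
    · refine ⟨n + 1, le_rfl, ?_⟩
      rw [downCount_succ] at h ⊢
      split_ifs at h ⊢ <;> omega

lemma path_eq_sub_downCount {ω : ℕ → ℤ} (hω : ∀ n, ω (n + 1) = ω n + 1 ∨ ω (n + 1) = ω n - 1)
    (n : ℕ) : ω n = ω 0 + n - 2 * downCount ω n := by
  induction n with
  | zero => simp [downCount_zero]
  | succ n ih =>
    rw [downCount_succ]
    rcases hω n with h | h
    · rw [if_neg (by omega)]
      push_cast
      omega
    · rw [if_pos h]
      push_cast
      omega

/-- A nearest-neighbour path is at or above its starting point at its `m`-th down-step iff it is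
strictly above it at time `2 * m - 1`. -/
lemma le_path_betaTime_iff {ω : ℕ → ℤ}
    (hω : ∀ n, ω (n + 1) = ω n + 1 ∨ ω (n + 1) = ω n - 1) {m : ℕ} (hm : 1 ≤ m) :
    ω 0 ≤ ω (betaTime ω m) ↔ ω 0 + 1 ≤ ω (2 * m - 1) := by
  have hend := path_eq_sub_downCount hω (2 * m - 1)
  rcases Set.eq_empty_or_nonempty {j | 1 ≤ j ∧ downCount ω j = m} with he | hne
  · have hb : betaTime ω m = 0 := by rw [betaTime, he, Nat.sInf_empty]
    have hlt : downCount ω (2 * m - 1) < m := by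
      by_contra! h
      obtain ⟨j, -, hj⟩ := exists_downCount_eq h
      refine Set.eq_empty_iff_forall_notMem.1 he j ⟨?_, hj⟩
      rcases Nat.eq_zero_or_pos j with rfl | h0
      · rw [downCount_zero] at hj
        omega
      · exact h0
    rw [hb]
    omega
  · obtain ⟨-, hβ⟩ : 1 ≤ betaTime ω m ∧ downCount ω (betaTime ω m) = m := Nat.sInf_mem hne
    have hval := path_eq_sub_downCount hω (betaTime ω m)
    have hiff : 2 * m ≤ betaTime ω m ↔ downCount ω (2 * m - 1) < m := by
      constructor
      · intro h
        by_contra! h'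
        obtain ⟨j, hj, hjm⟩ := exists_downCount_eq h'
        have hj1 : 1 ≤ j := by
          rcases Nat.eq_zero_or_pos j with rfl | h0
          · rw [downCount_zero] at hjm
            omega
          · exact h0
        have : betaTime ω m ≤ j := Nat.sInf_le ⟨hj1, hjm⟩
        omega
      · intro h
        by_contra! h'
        have := downCount_mono ω (show betaTime ω m ≤ 2 * m - 1 by omega)
        omega
    omega

lemma IsUrnChain.measureReal_betaTime {lam : ℝ} {P : ℤ → Measure (ℕ → ℤ)}
    (hP : IsUrnChain lam P) {m : ℕ} (hm : 1 ≤ m) (ℓ : ℤ) :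
    (P ℓ).real {ω | ℓ ≤ ω (betaTime ω m)} = urnTail lam (ℓ + 1) (2 * m - 1) ℓ := by
  rw [← hP.measureReal_tail]
  refine measureReal_congr ?_
  filter_upwards [hP.ae_path ℓ] with ω hω
  have h := le_path_betaTime_iff hω.2 hm
  rw [hω.1] at h
  exact propext h

/-- Monotonicity in the starting point: `ℓ ↦ P_ℓ(𝔇_{β_m} ≥ ℓ)` is non-increasing. -/
theorem urn_beta_monotone (lam : ℝ) (hlam : lam ∈ Set.Ioo (0 : ℝ) 1)
    (P : ℤ → Measure (ℕ → ℤ)) (hP : IsUrnChain lam P) :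
    ∀ (m : ℕ), 1 ≤ m → ∀ ℓ : ℤ,
      P (ℓ + 1) {ω | ℓ + 1 ≤ ω (betaTime ω m)} ≤ P ℓ {ω | ℓ ≤ ω (betaTime ω m)} := by
  intro m hm ℓ
  have := hP.1
  refine (ENNReal.toReal_le_toReal (measure_ne_top _ _) (measure_ne_top _ _)).1 ?_
  change (P (ℓ + 1)).real _ ≤ (P ℓ).real _
  rw [hP.measureReal_betaTime hm, hP.measureReal_betaTime hm]
  exact urnTail_shift_le hlam.1 hlam.2 (ℓ + 1) (2 * m - 1) ℓ
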